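/- arXiv:2410.08898 — 7 statements merged into one kernel-verified Lean document; each statement's English description precedes it below -/
import Mathlib

section
/- For any f : {-1,1}^N → ℝ and any min-degree interpolator g of f on X_{N0}, the Fourier support of g is contained in the subsets of [N0]; that is, ĝ(T) = 0 for every T ⊆ [N] with T ⊄ [N0]. -/
open Finset

noncomputable section

/-- The point of the Boolean cube `{-1,1}^N ⊆ ℝ^N` encoded by a sign pattern. -/
def toVec {N : ℕ} (σ : Fin N → Bool) : Fin N → ℝ := fun i => if σ i then 1 else -1

/-- The Fourier coefficient `f̂(T) = 2^{-N} ∑_{x ∈ {-1,1}^N} f(x) ∏_{i ∈ T} x_i`. -/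
def fCoeff {N : ℕ} (f : (Fin N → ℝ) → ℝ) (T : Finset (Fin N)) : ℝ :=
  (∑ σ : Fin N → Bool, f (toVec σ) * ∏ i ∈ T, toVec σ i) / 2 ^ N

/-- The degree profile: the `(N+1)`-tuple whose entry at (0-based) index `i` is
`∑_{|T| = N - i} f̂(T)²`. -/
def degP (N : ℕ) (f : (Fin N → ℝ) → ℝ) : Fin (N + 1) → ℝ :=
  fun i => ∑ T ∈ Finset.univ.filter (fun T : Finset (Fin N) => T.card = N - (i : ℕ)),
    fCoeff f T ^ 2

/-- Strict lexicographic order on tuples. -/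
def lexLt {n : ℕ} (a b : Fin n → ℝ) : Prop :=
  ∃ i, (∀ j, j < i → a j = b j) ∧ a i < b i

/-- Lexicographic order on tuples. -/
def lexLe {n : ℕ} (a b : Fin n → ℝ) : Prop := a = b ∨ lexLt a b

/-- `g` interpolates `f` on `X_{N0} = {x ∈ {-1,1}^N : x_i = 1 for all i > N0}`. -/
def Interpolates (N N0 : ℕ) (g f : (Fin N → ℝ) → ℝ) : Prop :=
  ∀ σ : Fin N → Bool, (∀ i : Fin N, N0 ≤ (i : ℕ) → σ i = true) → g (toVec σ) = f (toVec σ)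

/-- `g` is a min-degree interpolator of `f` on `X_{N0}`. -/
def MinDegInterpolator (N N0 : ℕ) (g f : (Fin N → ℝ) → ℝ) : Prop :=
  Interpolates N N0 g f ∧
    ∀ g' : (Fin N → ℝ) → ℝ, Interpolates N N0 g' f → lexLe (degP N g) (degP N g')


/-- The monomial `x ↦ ∏_{i ∈ S} x_i`. -/
def monomialFn {N : ℕ} (S : Finset (Fin N)) : (Fin N → ℝ) → ℝ := fun x => ∏ i ∈ S, x i

theorem fCoeff_monomialFn {N : ℕ} (S T : Finset (Fin N)) :
    fCoeff (monomialFn S) T = if S = T then 1 else 0 := by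
  have key : ∑ σ : Fin N → Bool, monomialFn S (toVec σ) * ∏ i ∈ T, toVec σ i
      = ∏ i : Fin N, if (i ∈ S ↔ i ∈ T) then (2 : ℝ) else 0 := by
    calc ∑ σ : Fin N → Bool, monomialFn S (toVec σ) * ∏ i ∈ T, toVec σ i
        = ∑ σ : Fin N → Bool, ∏ i : Fin N,
            ((if i ∈ S then (if σ i then (1 : ℝ) else -1) else 1) *
              (if i ∈ T then (if σ i then (1 : ℝ) else -1) else 1)) := by
          refine Finset.sum_congr rfl fun σ _ => ?_
          rw [Finset.prod_mul_distrib]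
          simp only [Finset.prod_ite_mem, Finset.univ_inter, monomialFn, toVec]
      _ = ∏ i : Fin N, ∑ b : Bool,
            ((if i ∈ S then (if b then (1 : ℝ) else -1) else 1) *
              (if i ∈ T then (if b then (1 : ℝ) else -1) else 1)) :=
          (Fintype.prod_sum fun (i : Fin N) (b : Bool) =>
            ((if i ∈ S then (if b then (1 : ℝ) else -1) else 1) *
              (if i ∈ T then (if b then (1 : ℝ) else -1) else 1))).symm
      _ = _ := by
          refine Finset.prod_congr rfl fun i _ => ?_
          by_cases hS : i ∈ S <;> by_cases hT : i ∈ T <;> simp [hS, hT, one_add_one_eq_two]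
  unfold fCoeff
  rw [key]
  split_ifs with h
  · simp [h]
  · obtain ⟨i, hi⟩ : ∃ i, ¬ (i ∈ S ↔ i ∈ T) := by
      simpa [Finset.ext_iff] using h
    rw [Finset.prod_eq_zero (Finset.mem_univ i) (if_neg hi), zero_div]

theorem fCoeff_add {N : ℕ} (f g : (Fin N → ℝ) → ℝ) (T : Finset (Fin N)) :
    fCoeff (f + g) T = fCoeff f T + fCoeff g T := by
  simp only [fCoeff, Pi.add_apply, add_mul, Finset.sum_add_distrib, add_div]

theorem fCoeff_smul {N : ℕ} (c : ℝ) (f : (Fin N → ℝ) → ℝ) (T : Finset (Fin N)) :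
    fCoeff (c • f) T = c * fCoeff f T := by
  simp only [fCoeff, Pi.smul_apply, smul_eq_mul, mul_assoc, ← Finset.mul_sum, mul_div_assoc]

theorem lexLt.not_lexLe {n : ℕ} {a b : Fin n → ℝ} (h : lexLt a b) : ¬ lexLe b a := by
  obtain ⟨i, hi, hlt⟩ := h
  rintro (rfl | ⟨j, hj, hlt'⟩)
  · exact lt_irrefl _ hlt
  · rcases lt_trichotomy i j with hij | rfl | hij
    · exact hlt.ne' (hj i hij)
    · exact lt_asymm hlt hlt'
    · exact hlt'.ne' (hi j hij)

/-- Killing one coefficient of `g` while changing otherwise only coefficients of smaller degree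
strictly decreases the degree profile. -/
theorem lexLt_degP_of_fCoeff {N : ℕ} {g g' : (Fin N → ℝ) → ℝ} {T : Finset (Fin N)}
    (hT : fCoeff g T ≠ 0) (hT' : fCoeff g' T = 0)
    (h : ∀ U : Finset (Fin N), T.card ≤ U.card → U ≠ T → fCoeff g' U = fCoeff g U) :
    lexLt (degP N g') (degP N g) := by
  have hcard : T.card ≤ N := by simpa using T.card_le_univ
  refine ⟨⟨N - T.card, by omega⟩, fun j hj => ?_, ?_⟩
  · refine Finset.sum_congr rfl fun U hU => ?_
    have hU : U.card = N - (j : ℕ) := (Finset.mem_filter.mp hU).2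
    have hj : (j : ℕ) < N - T.card := hj
    rw [h U (by omega) (by rintro rfl; omega)]
  · refine Finset.sum_lt_sum (fun U hU => ?_) ⟨T, ?_, ?_⟩
    · have hU : U.card = N - (N - T.card) := (Finset.mem_filter.mp hU).2
      rcases eq_or_ne U T with rfl | hne
      · rw [hT', zero_pow two_ne_zero]
        exact sq_nonneg _
      · rw [h U (by omega) hne]
    · simp only [Finset.mem_filter, Finset.mem_univ, true_and]
      omega
    · rw [hT', zero_pow two_ne_zero]
      exact sq_pos_of_ne_zero hT

theorem monomialFn_filter_lt {N N0 : ℕ} (T : Finset (Fin N)) {σ : Fin N → Bool}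
    (hσ : ∀ i : Fin N, N0 ≤ (i : ℕ) → σ i = true) :
    monomialFn (T.filter fun i => (i : ℕ) < N0) (toVec σ) = monomialFn T (toVec σ) := by
  refine Finset.prod_subset (Finset.filter_subset _ _) fun i hi hi' => ?_
  have : N0 ≤ (i : ℕ) := by simpa [hi] using hi'
  simp [toVec, hσ i this]

/-- Every min-degree interpolator on `X_{N0}` has Fourier support contained in subsets of `[N0]`. -/
theorem minDeg_support_subset (N N0 : ℕ) (hN0 : 1 ≤ N0) (hN : N0 ≤ N)
    (f g : (Fin N → ℝ) → ℝ) (hg : MinDegInterpolator N N0 g f) :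
    ∀ T : Finset (Fin N), ¬ (∀ i ∈ T, (i : ℕ) < N0) → fCoeff g T = 0 := by
  intro T hT
  by_contra hc
  set S := T.filter fun i : Fin N => (i : ℕ) < N0 with hS
  have hST : S ⊂ T := by
    rw [hS, Finset.filter_ssubset]
    simpa using hT
  have hcard := Finset.card_lt_card hST
  set g' := g + fCoeff g T • (monomialFn S + (-1 : ℝ) • monomialFn T) with hg'
  have hcoeff (U : Finset (Fin N)) : fCoeff g' U =
      fCoeff g U + fCoeff g T * ((if S = U then 1 else 0) + -1 * if T = U then 1 else 0) := by
    rw [hg', fCoeff_add, fCoeff_smul, fCoeff_add, fCoeff_smul, fCoeff_monomialFn,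
      fCoeff_monomialFn]
  have hinterp : Interpolates N N0 g' f := fun σ hσ => by
    simp [hg', hS, monomialFn_filter_lt T hσ, hg.1 σ hσ]
  refine (lexLt_degP_of_fCoeff hc ?_ fun U hU hne => ?_).not_lexLe (hg.2 g' hinterp)
  · simp [hcoeff, hST.ne]
  · have hSU : S ≠ U := by
      intro h
      rw [← h] at hU
      omega
    simp [hcoeff, hSU, hne.symm]

end
end

section
/- For every matrix Z ∈ ℝ^{N×N}, the uniform average over X_{N0} satisfies 2^{-N0} ∑_{x ∈ X_{N0}} (1/2)·⟨M_N^u ∘ (x e_{n(x)}ᵀ), Z⟩² = (1/2)·‖Q_{N0} ∘ Z‖_F², where Q_{N0} ∈ ℝ^{N×N} is defined by (Q_{N0})_{ij} = 2^{-(N0 - j + 1)/2} for 1 ≤ i ≤ j ≤ N0 and (Q_{N0})_{ij} = 0 otherwise. -/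
open Finset Matrix

noncomputable section

def cubeLow (N N0 : ℕ) : Finset (Fin N → Bool) :=
  Finset.univ.filter (fun σ => ∀ i : Fin N, N0 ≤ (i : ℕ) → σ i = true)

def nIdx {N : ℕ} (σ : Fin N → Bool) : ℕ :=
  Finset.univ.sup (fun i : Fin N => if σ i then 0 else (i : ℕ) + 1)

def eVec (N : ℕ) (k : ℕ) : Fin N → ℝ := fun i => if (i : ℕ) + 1 = k then 1 else 0

def outer {N : ℕ} (σ : Fin N → Bool) : Matrix (Fin N) (Fin N) ℝ :=
  Matrix.of fun i j => toVec σ i * eVec N (nIdx σ) j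

def frobInner {N : ℕ} (A B : Matrix (Fin N) (Fin N) ℝ) : ℝ :=
  ∑ i, ∑ j, A i j * B i j

def maskU (N : ℕ) : Matrix (Fin N) (Fin N) ℝ :=
  Matrix.of fun i j => if i ≤ j then 1 else 0

def bPLAA {N : ℕ} (i j : Fin N) (σ : Fin N → Bool) : ℝ :=
  (if i = j then -1 else toVec σ i) * ((1 - toVec σ j) / 2) *
    ∏ k ∈ Finset.univ.filter (fun k : Fin N => j < k), (1 + toVec σ k) / 2


/-- The matrix `Q_{N0}` with `(Q_{N0})_{ij} = 2^{-(N0-j+1)/2}` for `1 ≤ i ≤ j ≤ N0`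
(here in 0-based indexing) and `0` otherwise. -/
def Qmat (N N0 : ℕ) : Matrix (Fin N) (Fin N) ℝ :=
  Matrix.of fun i j =>
    if i ≤ j ∧ (j : ℕ) < N0 then (2 : ℝ) ^ (-(((N0 : ℝ) - (j : ℕ)) / 2)) else 0

/-- Signs whose last `-1` sits at position `j`. -/
def lastNegAt {N : ℕ} (j : Fin N) : Finset (Fin N → Bool) :=
  Fintype.piFinset fun k => if k < j then Finset.univ else if k = j then {false} else {true}

theorem mem_lastNegAt {N : ℕ} {j : Fin N} {σ : Fin N → Bool} :
    σ ∈ lastNegAt j ↔ σ j = false ∧ ∀ k, j < k → σ k = true := by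
  simp only [lastNegAt, Fintype.mem_piFinset]
  constructor
  · intro h
    refine ⟨by simpa using h j, fun k hk => ?_⟩
    simpa [hk.not_gt, hk.ne'] using h k
  · rintro ⟨hj, h⟩ k
    rcases lt_trichotomy k j with hk | rfl | hk
    · simp [hk]
    · simp [hj]
    · simp [hk.not_gt, hk.ne', h k hk]

theorem card_lastNegAt {N : ℕ} (j : Fin N) : (lastNegAt j).card = 2 ^ (j : ℕ) := by
  have h : ∀ k : Fin N, (if k < j then (Finset.univ : Finset Bool) else
      if k = j then {false} else {true}).card = if k < j then 2 else 1 := by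
    intro k
    split_ifs <;> simp
  simp only [lastNegAt, Fintype.card_piFinset, h]
  rw [← Finset.prod_filter, Finset.prod_const, Finset.filter_gt_eq_Iio, Fin.card_Iio]

theorem nIdx_eq_succ_iff {N : ℕ} (j : Fin N) (σ : Fin N → Bool) :
    nIdx σ = (j : ℕ) + 1 ↔ σ ∈ lastNegAt j := by
  rw [mem_lastNegAt]
  constructor
  · intro h
    have hle : ∀ k : Fin N, σ k = false → k ≤ j := by
      intro k hk
      have := Finset.le_sup (f := fun i : Fin N => if σ i then 0 else (i : ℕ) + 1)
        (Finset.mem_univ k)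
      simp only [hk] at this
      change _ ≤ nIdx σ at this
      rw [h] at this
      simpa using this
    refine ⟨?_, fun k hk => ?_⟩
    · obtain ⟨k, -, hk⟩ := Finset.exists_mem_eq_sup Finset.univ ⟨j, Finset.mem_univ j⟩
        (fun i : Fin N => if σ i then 0 else (i : ℕ) + 1)
      change nIdx σ = _ at hk
      rw [h] at hk
      cases hσ : σ k
      · have hjk : j = k := by
          ext
          simpa [hσ] using hk
        rwa [hjk]
      · simp [hσ] at hk
    · by_contra hσ
      exact absurd (hle k (by simpa using hσ)) hk.not_ge
  · rintro ⟨hj, h⟩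
    apply le_antisymm
    · refine Finset.sup_le fun k _ => ?_
      by_cases hk : j < k
      · simp [h k hk]
      · split_ifs
        · simp
        · have : (k : ℕ) ≤ j := not_lt.mp hk
          omega
    · have := Finset.le_sup (f := fun i : Fin N => if σ i then 0 else (i : ℕ) + 1)
        (Finset.mem_univ j)
      simp only [hj] at this
      exact this

theorem cubeLow_filter_nIdx {N N0 : ℕ} (j : Fin N) :
    (cubeLow N N0).filter (fun σ => (j : ℕ) + 1 = nIdx σ) =
      if (j : ℕ) < N0 then lastNegAt j else ∅ := by
  ext σ
  rw [Finset.mem_filter, eq_comm (a := (j : ℕ) + 1), nIdx_eq_succ_iff]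
  simp only [cubeLow, Finset.mem_filter, Finset.mem_univ, true_and]
  split_ifs with hj
  · refine ⟨And.right, fun h => ⟨fun i hi => (mem_lastNegAt.mp h).2 i ?_, h⟩⟩
    exact Fin.lt_def.mpr (hj.trans_le hi)
  · simp only [Finset.notMem_empty, iff_false, not_and]
    intro h hσ
    have := (mem_lastNegAt.mp hσ).1
    simp [h j (not_lt.mp hj)] at this

theorem toVec_mul_self {N : ℕ} (σ : Fin N → Bool) (i : Fin N) : toVec σ i * toVec σ i = 1 := by
  unfold toVec
  split_ifs <;> norm_num

/-- Flipping a free coordinate `a < j` shows that distinct coordinates are uncorrelated. -/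
theorem sum_lastNegAt_toVec_mul_of_lt {N : ℕ} {j a b : Fin N} (ha : a < j) (hab : a ≠ b) :
    ∑ σ ∈ lastNegAt j, toVec σ a * toVec σ b = 0 := by
  refine Finset.sum_involution (fun σ _ => Function.update σ a (!σ a)) ?_ ?_ ?_ ?_
  · intro σ _
    cases hσa : σ a <;> cases hσb : σ b <;> simp [toVec, hab.symm, hσa, hσb]
  · intro σ _ _ h
    have := congrFun h a
    simp at this
  · intro σ hσ
    rw [mem_lastNegAt] at hσ ⊢
    refine ⟨by simpa [ha.ne'] using hσ.1, fun k hk => ?_⟩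
    simpa [(ha.trans hk).ne'] using hσ.2 k hk
  · intro σ _
    simp

theorem sum_lastNegAt_toVec_mul {N : ℕ} {j a b : Fin N} (ha : a ≤ j) (hb : b ≤ j) :
    ∑ σ ∈ lastNegAt j, toVec σ a * toVec σ b = if a = b then 2 ^ (j : ℕ) else 0 := by
  split_ifs with hab
  · subst hab
    simp [toVec_mul_self, card_lastNegAt]
  · rcases lt_or_gt_of_ne hab with h | h
    · exact sum_lastNegAt_toVec_mul_of_lt (h.trans_le hb) hab
    · simp_rw [mul_comm (toVec _ a)]
      exact sum_lastNegAt_toVec_mul_of_lt (h.trans_le ha) (Ne.symm hab)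

theorem sum_lastNegAt_sq {N : ℕ} (j : Fin N) (z : Fin N → ℝ) :
    ∑ σ ∈ lastNegAt j, (∑ i ∈ Finset.Iic j, toVec σ i * z i) ^ 2 =
      2 ^ (j : ℕ) * ∑ i ∈ Finset.Iic j, z i ^ 2 := by
  simp_rw [sq, Finset.sum_mul_sum]
  rw [Finset.sum_comm, Finset.mul_sum]
  refine Finset.sum_congr rfl fun a ha => ?_
  rw [Finset.sum_comm]
  have h : ∀ b ∈ Finset.Iic j, ∑ σ ∈ lastNegAt j, toVec σ a * z a * (toVec σ b * z b) =
      if a = b then 2 ^ (j : ℕ) * (z a * z b) else 0 := by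
    intro b hb
    simp_rw [mul_mul_mul_comm _ (z a)]
    rw [← Finset.sum_mul, sum_lastNegAt_toVec_mul (Finset.mem_Iic.mp ha) (Finset.mem_Iic.mp hb),
      ite_mul, zero_mul]
  rw [Finset.sum_congr rfl h, Finset.sum_ite_eq, if_pos ha]

theorem frobInner_mask_outer {N : ℕ} (σ : Fin N → Bool) (Z : Matrix (Fin N) (Fin N) ℝ) :
    frobInner (Matrix.of fun i j => maskU N i j * outer σ i j) Z =
      ∑ j : Fin N, if (j : ℕ) + 1 = nIdx σ then ∑ i ∈ Finset.Iic j, toVec σ i * Z i j else 0 := by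
  rw [frobInner, Finset.sum_comm]
  refine Finset.sum_congr rfl fun j _ => ?_
  rw [← Finset.filter_ge_eq_Iic, Finset.sum_filter]
  split_ifs with hj <;> simp [maskU, outer, eVec, hj]

theorem sq_frobInner_mask_outer {N : ℕ} (σ : Fin N → Bool) (Z : Matrix (Fin N) (Fin N) ℝ) :
    frobInner (Matrix.of fun i j => maskU N i j * outer σ i j) Z ^ 2 =
      ∑ j : Fin N,
        if (j : ℕ) + 1 = nIdx σ then (∑ i ∈ Finset.Iic j, toVec σ i * Z i j) ^ 2 else 0 := by
  rw [frobInner_mask_outer]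
  by_cases h : ∃ j : Fin N, (j : ℕ) + 1 = nIdx σ
  · obtain ⟨j, hj⟩ := h
    simp [← hj, ← Fin.ext_iff]
  · push Not at h
    simp [h]

theorem sq_Qmat {N N0 : ℕ} (i j : Fin N) :
    Qmat N N0 i j ^ 2 = if i ≤ j ∧ (j : ℕ) < N0 then 1 / 2 ^ N0 * 2 ^ (j : ℕ) else 0 := by
  simp only [Qmat, Matrix.of_apply]
  split_ifs
  · rw [← Real.rpow_natCast, ← Real.rpow_mul (by norm_num),
      show -(((N0 : ℝ) - (j : ℕ)) / 2) * ((2 : ℕ) : ℝ) = (j : ℕ) - N0 by push_cast; ring,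
      Real.rpow_sub (by norm_num), Real.rpow_natCast, Real.rpow_natCast]
    ring
  · simp

/-- Uniform average over `X_{N0}` of the squared masked pairing with `Z` equals
half the squared Frobenius norm of `Q_{N0} ∘ Z`. -/
theorem expectation_masked_pairing (N N0 : ℕ) (hN0 : 1 ≤ N0) (hN : N0 ≤ N)
    (Z : Matrix (Fin N) (Fin N) ℝ) :
    (1 / 2 ^ N0 : ℝ) *
        ∑ σ ∈ cubeLow N N0,
          (1 / 2) * (frobInner (Matrix.of fun i j => maskU N i j * outer σ i j) Z) ^ 2 =
      (1 / 2) * ∑ i, ∑ j, (Qmat N N0 i j * Z i j) ^ 2 := by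
  rw [← Finset.mul_sum, mul_left_comm]
  congr 1
  simp_rw [sq_frobInner_mask_outer]
  rw [Finset.sum_comm, Finset.mul_sum, Finset.sum_comm (s := Finset.univ (α := Fin N))]
  refine Finset.sum_congr rfl fun j _ => ?_
  rw [← Finset.sum_filter, cubeLow_filter_nIdx]
  simp_rw [mul_pow, sq_Qmat]
  split_ifs with hj
  · rw [sum_lastNegAt_sq j fun i => Z i j, ← Finset.filter_ge_eq_Iic, Finset.sum_filter,
      ← mul_assoc, Finset.mul_sum]
    simp [hj]
  · simp [hj]

end
end

section
/- Let U ∈ ℝ^{N×N} be upper triangular. Then ⟨x e_{n(x)}ᵀ, U⟩ = 0 for all x ∈ X_{N0} if and only if U_{ij} = 0 for all indices with 1 ≤ i ≤ j ≤ N0. -/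
open Finset Matrix

noncomputable section

/-- If `j` is the last coordinate where `σ` is `false`, then `nIdx σ = j + 1`. -/
lemma nIdx_eq_of_last_false {N : ℕ} {σ : Fin N → Bool} {j : Fin N} (hj : σ j = false)
    (hlast : ∀ i, j < i → σ i = true) : nIdx σ = (j : ℕ) + 1 := by
  apply le_antisymm
  · refine Finset.sup_le fun i _ => ?_
    rcases lt_or_ge j i with h | h
    · simp [hlast i h]
    · have h' : (i : ℕ) ≤ j := h
      split_ifs <;> omega
  · simpa [hj, nIdx] using
      Finset.le_sup (f := fun i : Fin N => if σ i then 0 else (i : ℕ) + 1) (Finset.mem_univ j)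

lemma nIdx_le_of_mem_cubeLow {N N0 : ℕ} {σ : Fin N → Bool} (hσ : σ ∈ cubeLow N N0) :
    nIdx σ ≤ N0 := by
  simp only [cubeLow, Finset.mem_filter, Finset.mem_univ, true_and] at hσ
  refine Finset.sup_le fun i _ => ?_
  rcases lt_or_ge (i : ℕ) N0 with h | h
  · split_ifs <;> omega
  · simp [hσ i h]

lemma frobInner_outer_of_nIdx_eq {N : ℕ} {σ : Fin N → Bool} {j : Fin N}
    (hσ : nIdx σ = (j : ℕ) + 1) (U : Matrix (Fin N) (Fin N) ℝ) :
    frobInner (outer σ) U = ∑ i, toVec σ i * U i j := by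
  refine Finset.sum_congr rfl fun i _ => ?_
  rw [Finset.sum_eq_single j]
  · simp [outer, eVec, hσ]
  · intro k _ hk
    have : (k : ℕ) ≠ j := fun h => hk (Fin.ext h)
    simp [outer, eVec, hσ, this]
  · simp

/-- For upper triangular `U`, `⟨x e_{n(x)}ᵀ, U⟩ = 0` for all `x ∈ X_{N0}` iff
`U_{ij} = 0` for all `1 ≤ i ≤ j ≤ N0`. -/
theorem frobInner_zero_iff (N N0 : ℕ) (hN0 : 1 ≤ N0) (hN : N0 ≤ N)
    (U : Matrix (Fin N) (Fin N) ℝ) (hU : ∀ i j : Fin N, j < i → U i j = 0) :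
    (∀ σ ∈ cubeLow N N0, frobInner (outer σ) U = 0) ↔
      (∀ i j : Fin N, i ≤ j → (j : ℕ) < N0 → U i j = 0) := by
  constructor
  · intro h
    have column_sum : ∀ (σ : Fin N → Bool) (j : Fin N), (j : ℕ) < N0 → σ j = false →
        (∀ i, j < i → σ i = true) → ∑ i, toVec σ i * U i j = 0 := by
      intro σ j hj hσj hlast
      rw [← frobInner_outer_of_nIdx_eq (nIdx_eq_of_last_false hσj hlast)]
      refine h σ ?_
      simp only [cubeLow, Finset.mem_filter, Finset.mem_univ, true_and]
      exact fun i hi => hlast i (Fin.lt_def.2 (by omega))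
    have above_diag : ∀ i j : Fin N, i < j → (j : ℕ) < N0 → U i j = 0 := by
      intro i j hij hj
      have h₁ := column_sum (fun k => decide (k ≠ j)) j hj (by simp)
        (fun k hk => by simpa using hk.ne')
      have h₂ := column_sum (fun k => decide (k ≠ j ∧ k ≠ i)) j hj (by simp)
        (fun k hk => by simpa using ⟨hk.ne', (hij.trans hk).ne'⟩)
      have hdiff := congrArg₂ (· - ·) h₁ h₂
      simp only [← Finset.sum_sub_distrib] at hdiff
      rw [Finset.sum_eq_single i] at hdiff
      · simp [toVec, hij.ne] at hdiff
        linarith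
      · intro k _ hk
        simp [toVec, hk]
      · simp
    intro i j hij hj
    rcases hij.lt_or_eq with hlt | rfl
    · exact above_diag i j hlt hj
    have hdiag := column_sum (fun k => decide (k ≠ i)) i hj (by simp)
      (fun k hk => by simpa using hk.ne')
    rw [Finset.sum_eq_single i] at hdiag
    · simpa [toVec] using hdiag
    · intro k _ hk
      rcases lt_or_gt_of_ne hk with hlt | hgt
      · rw [above_diag k i hlt hj, mul_zero]
      · rw [hU k i hgt, mul_zero]
    · simp
  · intro h σ hσ
    have hle := nIdx_le_of_mem_cubeLow hσ
    refine Finset.sum_eq_zero fun i _ => Finset.sum_eq_zero fun j _ => ?_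
    by_cases hj : (j : ℕ) + 1 = nIdx σ
    · rcases le_or_gt i j with hij | hij
      · rw [h i j hij (by omega), mul_zero]
      · rw [hU i j hij, mul_zero]
    · simp [outer, eVec, hj]

end
end

section
/- Let A* ∈ ℝ^{N×N} be upper triangular, let α ≥ 0, and let P ∈ ℝ^{d×N} (d ≥ 1) satisfy (PᵀP)_{ij} = A*_{ij} for all 1 ≤ i ≤ j ≤ N0 and (PᵀP)_{ii} = α for all N0 < i ≤ N. Let Ã* be the truncation of A* defined by Ã*_{ij} = A*_{ij} if 1 ≤ i ≤ j ≤ N0 and Ã*_{ij} = 0 otherwise. Then ‖M_N^u ∘ (PᵀP) − Ã*‖_F² ≤ N·(N−N0)·α·max_{1≤i,j≤N}|A*_{ij}| + ((N−N0+1)(N−N0)/2)·α². -/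
open Finset Matrix

noncomputable section

theorem sq_gram_apply_le {m n : Type*} [Fintype m] (P : Matrix m n ℝ) (i j : n) :
    (Pᵀ * P) i j ^ 2 ≤ (Pᵀ * P) i i * (Pᵀ * P) j j := by
  simp only [Matrix.mul_apply, Matrix.transpose_apply, ← sq]
  exact Finset.sum_mul_sq_le_sq_mul_sq _ _ _

theorem sum_range_block_column (N N0 j : ℕ) (hj : N0 ≤ j) (hjN : j < N) (c a : ℝ) :
    ∑ i ∈ range N, (if i < N0 then c else if i ≤ j then a else 0) =
      N0 * c + ((j : ℝ) - N0 + 1) * a := by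
  obtain ⟨k, rfl⟩ := Nat.exists_eq_add_of_le hj
  obtain ⟨l, rfl⟩ := Nat.exists_eq_add_of_le (Nat.succ_le_of_lt hjN)
  have h₁ : ∑ i ∈ range N0, (if i < N0 then c else if i ≤ N0 + k then a else 0) = N0 * c := by
    rw [Finset.sum_congr rfl fun i hi => if_pos (mem_range.1 hi)]
    simp
  have h₂ : ∑ i ∈ range (k + 1),
      (if N0 + i < N0 then c else if N0 + i ≤ N0 + k then a else 0) = (k + 1) * a := by
    rw [Finset.sum_congr rfl fun i hi => by
      rw [if_neg (by omega), if_pos (by have := mem_range.1 hi; omega)]]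
    simp
  have h₃ : ∑ i ∈ range l, (if N0 + (k + 1) + i < N0 then c
      else if N0 + (k + 1) + i ≤ N0 + k then a else 0) = 0 :=
    Finset.sum_eq_zero fun i _ => by rw [if_neg (by omega), if_neg (by omega)]
  rw [show (N0 + k).succ + l = N0 + (k + 1) + l by omega, sum_range_add, sum_range_add,
    h₁, h₂, h₃]
  push_cast
  ring

theorem sum_range_tail_arithmetic (N N0 : ℕ) (hN : N0 ≤ N) (b a : ℝ) :
    ∑ j ∈ range N, (if N0 ≤ j then b + ((j : ℝ) - N0 + 1) * a else 0) =
      ((N : ℝ) - N0) * b + (((N : ℝ) - N0 + 1) * ((N : ℝ) - N0) / 2) * a := by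
  induction N, hN using Nat.le_induction with
  | base =>
    rw [Finset.sum_eq_zero fun j hj => if_neg (not_le.2 (mem_range.1 hj))]
    simp
  | succ n hn ih =>
    rw [sum_range_succ, ih, if_pos hn]
    push_cast
    ring

/-- Quantitative bound: `‖M_N^u ∘ (PᵀP) − Ã*‖_F² ≤ N(N−N0)α·max|A*| + ((N−N0+1)(N−N0)/2)α²`. -/
theorem masked_gram_close_to_truncation (N N0 : ℕ) (hN0 : 1 ≤ N0) (hN : N0 ≤ N)
    (d : ℕ) (hd : 1 ≤ d)
    (Astar : Matrix (Fin N) (Fin N) ℝ) (hA : ∀ i j : Fin N, j < i → Astar i j = 0)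
    (α : ℝ) (hα : 0 ≤ α)
    (P : Matrix (Fin d) (Fin N) ℝ)
    (hP1 : ∀ i j : Fin N, i ≤ j → (j : ℕ) < N0 → (Pᵀ * P) i j = Astar i j)
    (hP2 : ∀ i : Fin N, N0 ≤ (i : ℕ) → (Pᵀ * P) i i = α) :
    ∑ i, ∑ j,
        (maskU N i j * (Pᵀ * P) i j -
          (if i ≤ j ∧ (j : ℕ) < N0 then Astar i j else 0)) ^ 2 ≤
      (N : ℝ) * ((N : ℝ) - (N0 : ℝ)) * α *
          ((Finset.univ ×ˢ Finset.univ).sup'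
            ⟨(⟨0, by omega⟩, ⟨0, by omega⟩), Finset.mem_univ _⟩
            fun p : Fin N × Fin N => |Astar p.1 p.2|) +
        (((N : ℝ) - (N0 : ℝ) + 1) * ((N : ℝ) - (N0 : ℝ)) / 2) * α ^ 2 := by
  have hne : (Finset.univ ×ˢ Finset.univ : Finset (Fin N × Fin N)).Nonempty :=
    ⟨(⟨0, by omega⟩, ⟨0, by omega⟩), Finset.mem_univ _⟩
  set M := (Finset.univ ×ˢ Finset.univ).sup' hne fun p : Fin N × Fin N => |Astar p.1 p.2|
  have hAM (i j : Fin N) : |Astar i j| ≤ M :=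
    Finset.le_sup' (fun p : Fin N × Fin N => |Astar p.1 p.2|) (Finset.mem_univ (i, j))
  have hM0 : 0 ≤ M := (abs_nonneg _).trans (hAM ⟨0, by omega⟩ ⟨0, by omega⟩)
  have hNN : (N0 : ℝ) ≤ N := by exact_mod_cast hN
  have hterm (i j : Fin N) :
      (maskU N i j * (Pᵀ * P) i j - (if i ≤ j ∧ (j : ℕ) < N0 then Astar i j else 0)) ^ 2 ≤
        if N0 ≤ (j : ℕ) then
          (if (i : ℕ) < N0 then α * M else if (i : ℕ) ≤ j then α ^ 2 else 0) else 0 := by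
    by_cases hij : i ≤ j
    · by_cases hj : (j : ℕ) < N0
      · simp [maskU, hij, hj, hP1 i j hij hj, not_le.2 hj]
      · have hj' := not_lt.1 hj
        have hcs := sq_gram_apply_le P i j
        rw [hP2 j hj'] at hcs
        simp only [maskU, Matrix.of_apply, if_pos hij, hj, and_false, if_false, if_pos hj',
          one_mul, sub_zero]
        refine hcs.trans ?_
        split_ifs with hi hle
        · rw [hP1 i i le_rfl hi, mul_comm]
          exact mul_le_mul_of_nonneg_left ((le_abs_self _).trans (hAM i i)) hα
        · rw [hP2 i (not_lt.1 hi), sq]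
        · exact absurd hij hle
    · simp only [maskU, Matrix.of_apply, hij, false_and, if_false, zero_mul, sub_zero]
      split_ifs <;> simp <;> positivity
  calc _ ≤ ∑ i : Fin N, ∑ j : Fin N, (if N0 ≤ (j : ℕ) then
          (if (i : ℕ) < N0 then α * M else if (i : ℕ) ≤ j then α ^ 2 else 0) else 0) :=
        Finset.sum_le_sum fun i _ => Finset.sum_le_sum fun j _ => hterm i j
    _ = ∑ j : Fin N, (if N0 ≤ (j : ℕ) then
          N0 * (α * M) + (((j : ℕ) : ℝ) - N0 + 1) * α ^ 2 else 0) := by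
        rw [Finset.sum_comm]
        refine Finset.sum_congr rfl fun j _ => ?_
        split_ifs with hj
        · rw [← sum_range_block_column N N0 j hj j.2]
          exact Fin.sum_univ_eq_sum_range
            (fun i => if i < N0 then α * M else if i ≤ (j : ℕ) then α ^ 2 else 0) N
        · simp
    _ = ((N : ℝ) - N0) * (N0 * (α * M)) +
          (((N : ℝ) - N0 + 1) * ((N : ℝ) - N0) / 2) * α ^ 2 := by
        rw [← sum_range_tail_arithmetic N N0 hN]
        exact Fin.sum_univ_eq_sum_range
          (fun j => if N0 ≤ j then N0 * (α * M) + ((j : ℝ) - N0 + 1) * α ^ 2 else 0) N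
    _ ≤ _ := by
        have := mul_le_mul_of_nonneg_right hNN
          (mul_nonneg (sub_nonneg.2 hNN) (mul_nonneg hα hM0))
        linarith

end
end

section
/- Let A* ∈ ℝ^{N×N} be upper triangular, define the concept c(x) = ∑_{1 ≤ i ≤ j ≤ N} A*_{ij}·b_{ij}^{PLAA}(x), and let Â be the truncation Â_{ij} = A*_{ij} for 1 ≤ i ≤ j ≤ N0 and Â_{ij} = 0 otherwise, with ĝ(x) = ∑_{1 ≤ i ≤ j ≤ N} Â_{ij}·b_{ij}^{PLAA}(x). Then (i) ĝ(x) = c(x) for all x ∈ X_{N0}; and (ii) for every upper triangular A ∈ ℝ^{N×N} with ∑_{1 ≤ i ≤ j ≤ N} A_{ij}·b_{ij}^{PLAA}(x) = c(x) for all x ∈ X_{N0}, one has A_{ij} = A*_{ij} for all 1 ≤ i ≤ j ≤ N0, and consequently Â_{ij}² ≤ A_{ij}² for all 1 ≤ i ≤ j ≤ N. -/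
open Finset Matrix

noncomputable section

/-- If `j` is the last coordinate at which `σ` is `false`, only the `j`-th column of basis
functions survives at `σ`. -/
theorem bPLAA_eq_of_last_false {N : ℕ} {σ : Fin N → Bool} {j : Fin N} (hj : σ j = false)
    (hσ : ∀ k, j < k → σ k = true) (i l : Fin N) :
    bPLAA i l σ = if l = j then (if i = j then -1 else toVec σ i) else 0 := by
  unfold bPLAA
  rcases lt_trichotomy l j with h | rfl | h
  · rw [if_neg h.ne, Finset.prod_eq_zero (i := j) (by simpa using h) (by simp [toVec, hj]),
      mul_zero]
  · rw [Finset.prod_eq_one]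
    · simp [toVec, hj]
    · intro k hk
      simp [toVec, hσ k (by simpa using hk)]
  · simp [toVec, hσ l h, h.ne']

theorem sum_mul_bPLAA_of_last_false {N : ℕ} (A : Matrix (Fin N) (Fin N) ℝ) {σ : Fin N → Bool}
    {j : Fin N} (hj : σ j = false) (hσ : ∀ k, j < k → σ k = true) :
    ∑ p ∈ Finset.univ.filter (fun p : Fin N × Fin N => p.1 ≤ p.2),
        A p.1 p.2 * bPLAA p.1 p.2 σ =
      ∑ i ∈ Finset.Iio j, A i j * toVec σ i - A j j := by
  have hcol : ∀ i : Fin N, (∑ l, if i ≤ l then A i l * bPLAA i l σ else 0) =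
      if i ≤ j then A i j * (if i = j then -1 else toVec σ i) else 0 := by
    intro i
    rw [Finset.sum_eq_single j]
    · simp [bPLAA_eq_of_last_false hj hσ]
    · intro l _ hl
      simp [bPLAA_eq_of_last_false hj hσ, hl]
    · simp
  rw [Finset.sum_filter, Fintype.sum_prod_type]
  simp only [hcol]
  rw [← Finset.sum_filter, Finset.filter_ge_eq_Iic, ← Finset.Iio_insert,
    Finset.sum_insert (by simp)]
  rw [Finset.sum_congr rfl (g := fun i => A i j * toVec σ i)]
  · simp
    ring
  · intro i hi
    rw [if_neg (Finset.mem_Iio.1 hi).ne]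

theorem bPLAA_eq_zero_of_true {N : ℕ} {σ : Fin N → Bool} {j : Fin N} (hj : σ j = true)
    (i : Fin N) : bPLAA i j σ = 0 := by
  simp [bPLAA, toVec, hj]

/-- The values on `cubeLow N N0` determine the coefficients in the first `N0` columns. -/
theorem coeff_eq_of_eqOn_cubeLow {N N0 : ℕ} {A B : Matrix (Fin N) (Fin N) ℝ}
    (h : ∀ σ ∈ cubeLow N N0,
      (∑ p ∈ Finset.univ.filter (fun p : Fin N × Fin N => p.1 ≤ p.2),
          A p.1 p.2 * bPLAA p.1 p.2 σ) =
        ∑ p ∈ Finset.univ.filter (fun p : Fin N × Fin N => p.1 ≤ p.2),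
          B p.1 p.2 * bPLAA p.1 p.2 σ)
    {i j : Fin N} (hij : i ≤ j) (hj : (j : ℕ) < N0) : A i j = B i j := by
  have key : ∀ σ : Fin N → Bool, σ j = false → (∀ k, j < k → σ k = true) →
      ∑ i ∈ Finset.Iio j, (A i j - B i j) * toVec σ i = A j j - B j j := by
    intro σ hσj hσ
    have hmem : σ ∈ cubeLow N N0 := by
      simp only [cubeLow, Finset.mem_filter, Finset.mem_univ, true_and]
      exact fun k hk => hσ k (Fin.lt_def.2 (hj.trans_le hk))
    have := h σ hmem
    rw [sum_mul_bPLAA_of_last_false A hσj hσ, sum_mul_bPLAA_of_last_false B hσj hσ] at this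
    simp only [sub_mul, Finset.sum_sub_distrib]
    linarith
  let τ : Fin N → Bool := Function.update (fun _ => true) j false
  have hτj : τ j = false := by simp [τ]
  have hτ : ∀ k, k ≠ j → τ k = true := fun k hk => by simp [τ, hk]
  have hτsum := key τ hτj fun k hk => hτ k hk.ne'
  have hlt : ∀ m, m < j → A m j = B m j := by
    intro m hm
    have hflip := key (Function.update τ m false) (by simp [hm.ne', hτj]) fun k hk => by
      simp [(hm.trans hk).ne', hτ k hk.ne']
    have hdiff : ∑ i ∈ Finset.Iio j, ((A i j - B i j) * toVec τ i -
        (A i j - B i j) * toVec (Function.update τ m false) i) = 2 * (A m j - B m j) := by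
      rw [Finset.sum_eq_single m]
      · simp [toVec, hτ m hm.ne]
        ring
      · intro k _ hk
        simp [toVec, hk]
      · simp [hm]
    rw [Finset.sum_sub_distrib, hτsum, hflip] at hdiff
    linarith
  rcases hij.lt_or_eq with hij | rfl
  · exact hlt i hij
  · rw [Finset.sum_eq_zero] at hτsum
    · linarith
    · intro k hk
      simp [hlt k (Finset.mem_Iio.1 hk)]

/-- The truncation `Â` of an upper triangular `A*` to indices `1 ≤ i ≤ j ≤ N0` yields an
interpolator of the PLAA concept on `X_{N0}`, and any upper triangular interpolating
coefficient matrix `A` matches `A*` on those indices; consequently `Â_{ij}² ≤ A_{ij}²`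
for all `i ≤ j`. -/
theorem plaa_truncation_min_degree (N N0 : ℕ) (hN0 : 1 ≤ N0) (hN : N0 ≤ N)
    (Astar : Matrix (Fin N) (Fin N) ℝ) (hA : ∀ i j : Fin N, j < i → Astar i j = 0) :
    (∀ σ ∈ cubeLow N N0,
        (∑ p ∈ Finset.univ.filter (fun p : Fin N × Fin N => p.1 ≤ p.2),
            (if p.1 ≤ p.2 ∧ (p.2 : ℕ) < N0 then Astar p.1 p.2 else 0) * bPLAA p.1 p.2 σ) =
          ∑ p ∈ Finset.univ.filter (fun p : Fin N × Fin N => p.1 ≤ p.2),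
            Astar p.1 p.2 * bPLAA p.1 p.2 σ) ∧
    (∀ A : Matrix (Fin N) (Fin N) ℝ, (∀ i j : Fin N, j < i → A i j = 0) →
      (∀ σ ∈ cubeLow N N0,
          (∑ p ∈ Finset.univ.filter (fun p : Fin N × Fin N => p.1 ≤ p.2),
              A p.1 p.2 * bPLAA p.1 p.2 σ) =
            ∑ p ∈ Finset.univ.filter (fun p : Fin N × Fin N => p.1 ≤ p.2),
              Astar p.1 p.2 * bPLAA p.1 p.2 σ) →
      ((∀ i j : Fin N, i ≤ j → (j : ℕ) < N0 → A i j = Astar i j) ∧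
        ∀ i j : Fin N, i ≤ j →
          (if i ≤ j ∧ (j : ℕ) < N0 then Astar i j else 0) ^ 2 ≤ (A i j) ^ 2)) := by
  refine ⟨fun σ hσ => Finset.sum_congr rfl fun p hp => ?_, fun A _ h => ?_⟩
  · have hp : p.1 ≤ p.2 := by simpa using hp
    by_cases hp2 : (p.2 : ℕ) < N0
    · simp [hp, hp2]
    · have hσ : ∀ k : Fin N, N0 ≤ (k : ℕ) → σ k = true := by simpa [cubeLow] using hσ
      simp [bPLAA_eq_zero_of_true (hσ p.2 (not_lt.1 hp2))]
  · refine ⟨fun i j hij hj => coeff_eq_of_eqOn_cubeLow h hij hj, fun i j hij => ?_⟩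
    split_ifs with hj
    · rw [coeff_eq_of_eqOn_cubeLow h hij hj.2]
    · rw [zero_pow two_ne_zero]
      exact sq_nonneg _

end
end

section
/- Let U_1, …, U_r be a GRPE family and b_k(x) = ⟨x e_{n(x)}ᵀ, U_k⟩. Then for all i ≠ j, ∑_{x ∈ X_{N0}} b_i(x)·b_j(x) = 0. -/
open Finset Matrix

noncomputable section

/-- A GRPE family: upper triangular matrices of unit Frobenius norm with disjoint supports. -/
def GRPEFamily (N r : ℕ) (U : Fin r → Matrix (Fin N) (Fin N) ℝ) : Prop :=
  (∀ m : Fin r, ∀ i j : Fin N, j < i → U m i j = 0) ∧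
  (∀ m : Fin r, frobInner (U m) (U m) = 1) ∧
  (∀ m m' : Fin r, m ≠ m' → ∀ i j : Fin N, U m i j * U m' i j = 0)

/-- `b_k(x) = ⟨x e_{n(x)}ᵀ, U_k⟩`. -/
def bfun {N r : ℕ} (U : Fin r → Matrix (Fin N) (Fin N) ℝ) (k : Fin r)
    (σ : Fin N → Bool) : ℝ :=
  frobInner (outer σ) (U k)

theorem nIdx_eq_succ_iff_s13 {N : ℕ} (σ : Fin N → Bool) (c : Fin N) :
    (c : ℕ) + 1 = nIdx σ ↔ σ c = false ∧ ∀ k, c < k → σ k = true := by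
  have hle : ∀ k, (if σ k then 0 else (k : ℕ) + 1) ≤ nIdx σ := fun k =>
    Finset.le_sup (f := fun i : Fin N => if σ i then 0 else (i : ℕ) + 1) (Finset.mem_univ k)
  constructor
  · intro h
    constructor
    · obtain ⟨k, -, hk⟩ := Finset.exists_mem_eq_sup Finset.univ ⟨c, Finset.mem_univ c⟩
        (fun i : Fin N => if σ i then 0 else (i : ℕ) + 1)
      change nIdx σ = _ at hk
      rw [← h] at hk
      by_cases hs : σ k = true
      · simp [hs] at hk
      · simp only [hs, Bool.false_eq_true, if_false] at hk
        have : c = k := Fin.ext (by omega)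
        simpa [this] using hs
    · intro k hk
      by_contra hs
      have := hle k
      simp only [hs, if_false] at this
      have : (c : ℕ) < k := hk
      omega
  · rintro ⟨hc, hk⟩
    refine le_antisymm (by simpa [hc] using hle c) (Finset.sup_le fun k _ => ?_)
    rcases lt_or_ge c k with h | h
    · simp [hk k h]
    · have : (k : ℕ) ≤ c := h
      split_ifs <;> omega

/-- Flipping the `a`-th sign reverses each summand while preserving `nIdx σ = c + 1`. -/
theorem sum_cubeLow_eVec_nIdx_eq_zero {N : ℕ} (N0 : ℕ) {a a' c : Fin N} (hac : a < c)
    (haa' : a ≠ a') :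
    ∑ σ ∈ cubeLow N N0, toVec σ a * toVec σ a' * eVec N (nIdx σ) c = 0 := by
  rcases lt_or_ge (a : ℕ) N0 with ha | ha
  · have hupd : ∀ σ : Fin N → Bool,
        eVec N (nIdx (Function.update σ a (!σ a))) c = eVec N (nIdx σ) c := by
      intro σ
      simp only [eVec, nIdx_eq_succ_iff_s13]
      have : ∀ k, c ≤ k → Function.update σ a (!σ a) k = σ k := fun k hk =>
        Function.update_of_ne (hac.trans_le hk).ne' _ _
      congr 1
      rw [this c le_rfl]
      exact propext (and_congr_right fun _ =>
        forall_congr' fun k => imp_congr_right fun hk => by rw [this k hk.le])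
    have hneg : ∀ σ : Fin N → Bool,
        toVec (Function.update σ a (!σ a)) a = -toVec σ a := by
      intro σ
      cases h : σ a <;> simp [toVec, h]
    refine Finset.sum_involution (fun σ _ => Function.update σ a (!σ a)) ?_ ?_ ?_ ?_
    · intro σ _
      have : toVec (Function.update σ a (!σ a)) a' = toVec σ a' := by
        simp [toVec, Function.update_of_ne haa'.symm]
      rw [hupd, hneg, this]
      ring
    · intro σ _ _ h
      simpa using congrFun h a
    · intro σ hσ
      simp only [cubeLow, Finset.mem_filter, Finset.mem_univ, true_and] at hσ ⊢
      intro k hk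
      have hka : k ≠ a := by
        rintro rfl
        omega
      rw [Function.update_of_ne hka, hσ k hk]
    · intro σ _
      simp
  · refine Finset.sum_eq_zero fun σ hσ => ?_
    simp only [cubeLow, Finset.mem_filter, Finset.mem_univ, true_and] at hσ
    have hc : σ c = true := hσ c (ha.trans hac.le)
    simp [eVec, nIdx_eq_succ_iff_s13, hc]

/-- For a GRPE family, the functions `b_k` are orthogonal over `X_{N0}`. -/
theorem bfun_orthogonal (N N0 r : ℕ) (hN0 : 1 ≤ N0) (hN : N0 ≤ N)
    (U : Fin r → Matrix (Fin N) (Fin N) ℝ) (hU : GRPEFamily N r U) :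
    ∀ i j : Fin r, i ≠ j →
      ∑ σ ∈ cubeLow N N0, bfun U i σ * bfun U j σ = 0 := by
  intro i j hij
  obtain ⟨htri, -, hdisj⟩ := hU
  simp only [bfun, frobInner, outer, Matrix.of_apply, Finset.sum_mul_sum]
  rw [Finset.sum_comm]
  refine Finset.sum_eq_zero fun a _ => ?_
  rw [Finset.sum_comm]
  refine Finset.sum_eq_zero fun a' _ => ?_
  rw [Finset.sum_comm]
  refine Finset.sum_eq_zero fun c _ => ?_
  rw [Finset.sum_comm]
  refine Finset.sum_eq_zero fun c' _ => ?_
  by_cases hcc : c = c'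
  · subst hcc
    have hfactor : ∀ σ : Fin N → Bool,
        toVec σ a * eVec N (nIdx σ) c * U i a c * (toVec σ a' * eVec N (nIdx σ) c * U j a' c) =
          U i a c * U j a' c * (toVec σ a * toVec σ a' * eVec N (nIdx σ) c) := by
      intro σ
      have hsq : eVec N (nIdx σ) c * eVec N (nIdx σ) c = eVec N (nIdx σ) c := by
        simp [eVec]
      linear_combination (U i a c * U j a' c * toVec σ a * toVec σ a') * hsq
    simp only [hfactor, ← Finset.mul_sum]
    by_cases haa : a = a'
    · subst haa
      rw [hdisj i j hij, zero_mul]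
    rcases lt_trichotomy a c with h | h | h
    · rw [sum_cubeLow_eVec_nIdx_eq_zero N0 h haa, mul_zero]
    · rcases lt_or_gt_of_ne haa with h' | h'
      · rw [htri j a' c (h ▸ h'), mul_zero, zero_mul]
      · simp only [mul_comm (toVec _ a)]
        rw [sum_cubeLow_eVec_nIdx_eq_zero N0 (h ▸ h') (Ne.symm haa), mul_zero]
    · rw [htri i a c h, zero_mul, zero_mul]
  · refine Finset.sum_eq_zero fun σ _ => ?_
    have hzero : eVec N (nIdx σ) c * eVec N (nIdx σ) c' = 0 := by
      simp only [eVec, mul_ite, mul_one, mul_zero, ite_eq_right_iff, one_ne_zero, imp_false]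
      intro h h'
      exact hcc (Fin.ext (by omega))
    linear_combination (toVec σ a * toVec σ a' * U i a c * U j a' c') * hzero

end
end

section
/- Let U_1, …, U_r be a GRPE family and b_k(x) = ⟨x e_{n(x)}ᵀ, U_k⟩. If c, c̃ ∈ ℝ^r satisfy ∑_{k=1}^r c_k·b_k(x) = ∑_{k=1}^r c̃_k·b_k(x) for all x ∈ X_{N0}, then c_k = c̃_k for every k such that (U_k)_{ij} ≠ 0 for some 1 ≤ i ≤ j ≤ N0. -/
open Finset Matrix

noncomputable section

/-- If the last `-1` of `σ` sits at position `j`, then `n(σ) = j + 1`. -/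
lemma nIdx_eq_of_last {N : ℕ} {σ : Fin N → Bool} {j : Fin N} (hj : σ j = false)
    (hlast : ∀ k, j < k → σ k = true) : nIdx σ = (j : ℕ) + 1 := by
  apply le_antisymm
  · refine Finset.sup_le fun k _ => ?_
    by_cases hk : j < k
    · simp [hlast k hk]
    · have hkj : (k : ℕ) ≤ j := not_lt.mp hk
      split_ifs <;> omega
  · refine le_trans ?_ (Finset.le_sup
      (f := fun i : Fin N => if σ i then 0 else (i : ℕ) + 1) (Finset.mem_univ j))
    simp [hj]

/-- Pairing with `x e_{n(x)}ᵀ` reads off the column of the last `-1`. -/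
lemma frobInner_outer_of_last {N : ℕ} {σ : Fin N → Bool} {j : Fin N} (hj : σ j = false)
    (hlast : ∀ k, j < k → σ k = true) (A : Matrix (Fin N) (Fin N) ℝ) :
    frobInner (outer σ) A = ∑ i, toVec σ i * A i j := by
  simp [frobInner, outer, eVec, nIdx_eq_of_last hj hlast, Fin.val_inj]

/-- An upper triangular matrix orthogonal to `x e_{n(x)}ᵀ` for all `x ∈ X_{N0}` vanishes on the
first `N0` columns. -/
lemma eq_zero_of_frobInner_outer_eq_zero {N N0 : ℕ} {V : Matrix (Fin N) (Fin N) ℝ}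
    (htri : ∀ i j, j < i → V i j = 0) (hV : ∀ σ ∈ cubeLow N N0, frobInner (outer σ) V = 0)
    (i j : Fin N) (hj : (j : ℕ) < N0) : V i j = 0 := by
  have key (σ : Fin N → Bool) (hσ : σ j = false) (hlast : ∀ k, j < k → σ k = true) :
      ∑ i, toVec σ i * V i j = 0 := by
    rw [← frobInner_outer_of_last hσ hlast]
    refine hV σ (Finset.mem_filter.mpr ⟨Finset.mem_univ _, fun k hk => hlast k ?_⟩)
    exact Fin.lt_def.mpr (by omega)
  have single := key (fun k => decide (k ≠ j)) (by simp) fun k hk => by simp [hk.ne']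
  have above (i : Fin N) (hij : i < j) : V i j = 0 := by
    have pair := key (fun k => decide (k ≠ j ∧ k ≠ i)) (by simp) fun k hk => by
      simp [hk.ne', (hij.trans hk).ne']
    have hdiff := congrArg₂ (· - ·) single pair
    simp only [← Finset.sum_sub_distrib] at hdiff
    rw [Finset.sum_eq_single i] at hdiff
    · simp [toVec, hij.ne] at hdiff
      linarith
    · intro k _ hk
      simp [toVec, hk]
    · simp
  rcases lt_trichotomy i j with h | rfl | h
  · exact above i h
  · rw [Finset.sum_eq_single i] at single
    · simpa [toVec] using single
    · intro k _ hk
      rcases hk.lt_or_gt with h | h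
      · simp [above k h]
      · simp [htri k i h]
    · simp
  · exact htri i j h

lemma frobInner_sum_smul {N r : ℕ} (A : Matrix (Fin N) (Fin N) ℝ) (d : Fin r → ℝ)
    (U : Fin r → Matrix (Fin N) (Fin N) ℝ) :
    frobInner A (∑ k, d k • U k) = ∑ k, d k * frobInner A (U k) := by
  simp only [frobInner, Matrix.sum_apply, Matrix.smul_apply, smul_eq_mul, Finset.mul_sum]
  rw [Finset.sum_comm (s := (Finset.univ : Finset (Fin r)))]
  refine Finset.sum_congr rfl fun i _ => ?_
  rw [Finset.sum_comm]
  exact Finset.sum_congr rfl fun k _ => Finset.sum_congr rfl fun j _ => by ring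

/-- Coefficients of GRPE expansions agreeing on `X_{N0}` coincide on every `k` whose
matrix `U_k` has a nonzero entry in the `[N0] × [N0]` upper triangle. -/
theorem coeff_unique_on_active (N N0 r : ℕ) (hN0 : 1 ≤ N0) (hN : N0 ≤ N)
    (U : Fin r → Matrix (Fin N) (Fin N) ℝ) (hU : GRPEFamily N r U)
    (c c' : Fin r → ℝ)
    (hagree : ∀ σ ∈ cubeLow N N0, (∑ k, c k * bfun U k σ) = ∑ k, c' k * bfun U k σ) :
    ∀ k : Fin r, (∃ i j : Fin N, i ≤ j ∧ (j : ℕ) < N0 ∧ U k i j ≠ 0) → c k = c' k := by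
  rintro k ⟨i, j, -, hj, hk⟩
  obtain ⟨htri, -, hdisj⟩ := hU
  have hzero := eq_zero_of_frobInner_outer_eq_zero (N0 := N0) (V := ∑ m, (c m - c' m) • U m)
    (fun i j hij => by simp [Matrix.sum_apply, htri _ i j hij])
    (fun σ hσ => by
      rw [frobInner_sum_smul]
      simpa [bfun, sub_mul, sub_eq_zero] using hagree σ hσ) i j hj
  rw [Matrix.sum_apply, Finset.sum_eq_single k] at hzero
  · simpa [hk, sub_eq_zero] using hzero
  · intro m _ hm
    simp [(mul_eq_zero.mp (hdisj m k hm i j)).resolve_right hk]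
  · simp

end
end
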